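/- Let Ω, Ω' ⊂ ℂ be plane domains, let φ : Ω → Ω' be a conformal homeomorphism, let 1 ≤ q < p < ∞, and suppose there is K < ∞ with (∫_Ω |∇(f∘φ)|^q dμ)^{1/q} ≤ K (∫_{Ω'} |∇f|^p dμ)^{1/p} for all f ∈ C_0^∞(Ω'). Define κ by 1/κ = 1/q − 1/p and, for each open bounded A' ⊂ Ω', set Φ(A') = sup { (‖∇(f∘φ) | L_q(Ω)‖ / ‖∇f | L_p(A')‖)^κ : f ∈ C_0^∞(A'), ∇f not identically 0 }. Then Φ is a bounded, monotone, countably additive set function on open bounded subsets of Ω': (i) Φ(A') ≤ K^κ for all open bounded A' ⊂ Ω'; (ii) Φ(A'₁) ≤ Φ(A'₂) whenever A'₁ ⊂ A'₂; (iii) for every countable family of pairwise disjoint open bounded sets A'_k ⊂ Ω', Σ_k Φ(A'_k) ≤ Φ(⋃_k A'_k). -/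

import Mathlib

open MeasureTheory Set Filter
open scoped ENNReal Topology

/-- If two functions have disjoint topological supports, the Dirichlet `t`-energy of a linear
combination of their compositions with a continuous map splits. -/
theorem lintegral_fderiv_comp_add_of_disjoint {S : Set ℂ} (hS : IsOpen S) {ψ : ℂ → ℂ}
    (hψ : ContinuousOn ψ S) {t : ℝ} (ht : 0 < t) {f g : ℂ → ℝ}
    (hfg : Disjoint (tsupport f) (tsupport g)) {c d : ℝ} (hc : 0 ≤ c) (hd : 0 ≤ d) :
    ∫⁻ z in S, ENNReal.ofReal (‖fderiv ℝ ((c • f + d • g) ∘ ψ) z‖ ^ t) =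
      ENNReal.ofReal (c ^ t) * (∫⁻ z in S, ENNReal.ofReal (‖fderiv ℝ (f ∘ ψ) z‖ ^ t)) +
      ENNReal.ofReal (d ^ t) * (∫⁻ z in S, ENNReal.ofReal (‖fderiv ℝ (g ∘ ψ) z‖ ^ t)) := by
  have hm : ∀ h : ℂ → ℝ, Measurable fun z => ENNReal.ofReal (‖fderiv ℝ (h ∘ ψ) z‖ ^ t) :=
    fun h => ENNReal.measurable_ofReal.comp
      ((measurable_fderiv ℝ (h ∘ ψ)).norm.pow_const t)
  rw [← lintegral_const_mul _ (hm f), ← lintegral_const_mul _ (hm g),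
    ← lintegral_add_left ((hm f).const_mul _)]
  refine setLIntegral_congr_fun hS.measurableSet fun z hz => ?_
  have hψz : ContinuousAt ψ z := hψ.continuousAt (hS.mem_nhds hz)
  have vanish : ∀ h : ℂ → ℝ, ψ z ∉ tsupport h → ∀ᶠ y in 𝓝 z, h (ψ y) = 0 := fun h hh =>
    hψz.eventually (notMem_tsupport_iff_eventuallyEq.1 hh)
  have scale : ∀ (h : ℂ → ℝ) (a : ℝ), 0 ≤ a →
      ENNReal.ofReal (‖fderiv ℝ (a • (h ∘ ψ)) z‖ ^ t) =
        ENNReal.ofReal (a ^ t) * ENNReal.ofReal (‖fderiv ℝ (h ∘ ψ) z‖ ^ t) := by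
    intro h a ha
    rw [fderiv_const_smul_field, Pi.smul_apply, norm_smul, Real.norm_of_nonneg ha,
      Real.mul_rpow ha (norm_nonneg _), ENNReal.ofReal_mul (by positivity)]
  have zero : ∀ h : ℂ → ℝ, ψ z ∉ tsupport h →
      ENNReal.ofReal (‖fderiv ℝ (h ∘ ψ) z‖ ^ t) = 0 := by
    intro h hh
    have : h ∘ ψ =ᶠ[𝓝 z] fun _ => (0 : ℝ) := vanish h hh
    rw [this.fderiv_eq]
    simp [Real.zero_rpow ht.ne']
  by_cases hz' : ψ z ∈ tsupport f
  · have hg := Set.disjoint_left.1 hfg hz'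
    have : (c • f + d • g) ∘ ψ =ᶠ[𝓝 z] c • (f ∘ ψ) := by
      filter_upwards [vanish g hg] with y hy
      simp [hy]
    rw [this.fderiv_eq, scale f c hc, zero g hg, mul_zero, add_zero]
  · have : (c • f + d • g) ∘ ψ =ᶠ[𝓝 z] d • (g ∘ ψ) := by
      filter_upwards [vanish f hz'] with y hy
      simp [hy]
    rw [this.fderiv_eq, scale g d hd, zero f hz', mul_zero, zero_add]

theorem setLIntegral_fderiv_eq_lintegral {A : Set ℂ} {f : ℂ → ℝ} (hf : tsupport f ⊆ A)
    {t : ℝ} (ht : 0 < t) :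
    ∫⁻ w in A, ENNReal.ofReal (‖fderiv ℝ f w‖ ^ t) =
      ∫⁻ w, ENNReal.ofReal (‖fderiv ℝ f w‖ ^ t) := by
  refine setLIntegral_eq_of_support_subset fun w hw => hf ?_
  refine support_fderiv_subset ℝ (f := f) fun h => hw ?_
  simp [h, Real.zero_rpow ht.ne']

/-- The scaling of a function which makes both the `q`-energy `e` and the `p`-energy `n` equal
to the `κ`-th power of the ratio of the corresponding norms. -/
theorem exists_scaling_eq_ratio {p q κ : ℝ} (hq : 0 < q) (hqp : q < p)
    (hκ : 1 / κ = 1 / q - 1 / p) {e n : ℝ≥0∞} (he : e ≠ ∞)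
    (hr : (e ^ (1 / q) / n ^ (1 / p)) ^ κ ≠ 0) (hn : n ≠ 0) :
    ∃ c : ℝ, 0 ≤ c ∧ ENNReal.ofReal (c ^ q) * e = (e ^ (1 / q) / n ^ (1 / p)) ^ κ ∧
      ENNReal.ofReal (c ^ p) * n = (e ^ (1 / q) / n ^ (1 / p)) ^ κ := by
  have hp : 0 < p := hq.trans hqp
  have hκ0 : 0 < κ := by
    rw [← one_div_pos, hκ, sub_pos]
    exact one_div_lt_one_div_of_lt hq hqp
  have hn' : n ≠ ∞ := by
    rintro rfl
    simp [hp, hκ0] at hr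
  have he0 : e ≠ 0 := by
    rintro rfl
    simp [hq, hκ0] at hr
  obtain ⟨x, hx, rfl⟩ : ∃ x : ℝ, 0 < x ∧ e = ENNReal.ofReal x :=
    ⟨e.toReal, ENNReal.toReal_pos he0 he, (ENNReal.ofReal_toReal he).symm⟩
  obtain ⟨y, hy, rfl⟩ : ∃ y : ℝ, 0 < y ∧ n = ENNReal.ofReal y :=
    ⟨n.toReal, ENNReal.toReal_pos hn hn', (ENNReal.ofReal_toReal hn').symm⟩
  have hE : (ENNReal.ofReal x ^ (1 / q) / ENNReal.ofReal y ^ (1 / p)) ^ κ =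
      ENNReal.ofReal ((x ^ (1 / q) / y ^ (1 / p)) ^ κ) := by
    rw [ENNReal.ofReal_rpow_of_pos hx, ENNReal.ofReal_rpow_of_pos hy,
      ← ENNReal.ofReal_div_of_pos (by positivity), ENNReal.ofReal_rpow_of_pos (by positivity)]
  rw [hE]
  have hκ' : κ * (1 / q) = 1 + κ * (1 / p) := by
    have : κ * (1 / κ) = 1 := by field_simp
    rw [hκ] at this
    linarith
  set u := Real.log x
  set v := Real.log y
  have hxu : x = Real.exp u := (Real.exp_log hx).symm
  have hyv : y = Real.exp v := (Real.exp_log hy).symm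
  refine ⟨Real.exp ((κ * (u / q - v / p) - v) / p), (Real.exp_pos _).le, ?_, ?_⟩
  all_goals
    rw [← ENNReal.ofReal_mul (by positivity), hxu, hyv]
    congr 1
    simp only [← Real.exp_mul, ← Real.exp_add, ← Real.exp_sub]
    congr 1
  · have hqκ : κ * (p - q) = p * q := by field_simp at hκ; linarith
    field_simp
    linear_combination (-(u * p - v * q)) * hqκ
  · field_simp
    ring


/-- Let `φ : Ω → Ω'` be a conformal homeomorphism between plane
domains inducing a bounded composition operator `L¹_p(Ω') → L¹_q(Ω)` with norm
bound `K`, `1 ≤ q < p < ∞`, and let `κ` satisfy `1/κ = 1/q − 1/p`. Then the set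
function `Φ(A') = sup_f (‖∇(f∘φ)|L_q(Ω)‖ / ‖∇f|L_p(A')‖)^κ`, the supremum being
over `f ∈ C_0^∞(A')` with `∇f` not identically zero, is bounded by `K^κ`,
monotone, and countably additive on open bounded subsets of `Ω'`. -/
theorem composition_operator_set_function
    (Ω Ω' : Set ℂ) (hΩo : IsOpen Ω) (hΩc : IsConnected Ω)
    (hΩ'o : IsOpen Ω') (hΩ'c : IsConnected Ω')
    (φ : ℂ → ℂ) (hφd : DifferentiableOn ℂ φ Ω) (hφbij : Set.BijOn φ Ω Ω')
    (p q : ℝ) (hq : 1 ≤ q) (hqp : q < p)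
    (K : ℝ) (hKpos : 0 ≤ K)
    (hK : ∀ f : ℂ → ℝ, ContDiff ℝ (⊤ : ℕ∞) f → HasCompactSupport f →
      tsupport f ⊆ Ω' →
      (∫⁻ z in Ω, ENNReal.ofReal (‖fderiv ℝ (f ∘ φ) z‖ ^ q)) ^ (1 / q)
        ≤ ENNReal.ofReal K *
          (∫⁻ w in Ω', ENNReal.ofReal (‖fderiv ℝ f w‖ ^ p)) ^ (1 / p))
    (κ : ℝ) (hκ : 1 / κ = 1 / q - 1 / p)
    (Φ : Set ℂ → ℝ≥0∞)
    (hΦ : ∀ A : Set ℂ,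
      Φ A = ⨆ (f : ℂ → ℝ) (_ : ContDiff ℝ (⊤ : ℕ∞) f ∧ HasCompactSupport f ∧
          tsupport f ⊆ A ∧ ∃ z, fderiv ℝ f z ≠ 0),
        ((∫⁻ z in Ω, ENNReal.ofReal (‖fderiv ℝ (f ∘ φ) z‖ ^ q)) ^ (1 / q) /
          (∫⁻ w in A, ENNReal.ofReal (‖fderiv ℝ f w‖ ^ p)) ^ (1 / p)) ^ κ) :
    (∀ A : Set ℂ, IsOpen A → Bornology.IsBounded A → A ⊆ Ω' →
      Φ A ≤ ENNReal.ofReal K ^ κ) ∧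
    (∀ A₁ A₂ : Set ℂ, IsOpen A₁ → Bornology.IsBounded A₁ → A₁ ⊆ Ω' →
      IsOpen A₂ → Bornology.IsBounded A₂ → A₂ ⊆ Ω' → A₁ ⊆ A₂ → Φ A₁ ≤ Φ A₂) ∧
    (∀ A : ℕ → Set ℂ,
      (∀ k, IsOpen (A k) ∧ Bornology.IsBounded (A k) ∧ A k ⊆ Ω') →
      Pairwise (Function.onFun Disjoint A) →
      (∑' k, Φ (A k)) ≤ Φ (⋃ k, A k)) := by

  have hq0 : 0 < q := by linarith
  have hp0 : 0 < p := hq0.trans hqp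
  have hκ0 : 0 < κ := by
    rw [← one_div_pos, hκ, sub_pos]
    exact one_div_lt_one_div_of_lt hq0 hqp
  have mono : ∀ A₁ A₂ : Set ℂ, A₁ ⊆ A₂ → Φ A₁ ≤ Φ A₂ := by
    intro A₁ A₂ h
    rw [hΦ, hΦ]
    refine iSup₂_le fun f hf => ?_
    refine le_iSup₂_of_le f ⟨hf.1, hf.2.1, hf.2.2.1.trans h, hf.2.2.2⟩ ?_
    rw [setLIntegral_fderiv_eq_lintegral hf.2.2.1 hp0,
      setLIntegral_fderiv_eq_lintegral (hf.2.2.1.trans h) hp0]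
  have superadd : ∀ A B : Set ℂ, A ⊆ Ω' → B ⊆ Ω' → Disjoint A B → Φ A + Φ B ≤ Φ (A ∪ B) := by
    intro A B hA hB hAB
    rcases eq_or_ne (Φ A) 0 with h0 | hA0
    · rw [h0, zero_add]
      exact mono _ _ subset_union_right
    rcases eq_or_ne (Φ B) 0 with h0 | hB0
    · rw [h0, add_zero]
      exact mono _ _ subset_union_left
    have nonempty : ∀ C, Φ C ≠ 0 → ∃ f : ℂ → ℝ, ContDiff ℝ (⊤ : ℕ∞) f ∧ HasCompactSupport f ∧
        tsupport f ⊆ C ∧ ∃ z, fderiv ℝ f z ≠ 0 := by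
      intro C hC
      contrapose! hC
      rw [hΦ, ← le_zero_iff]
      exact iSup₂_le fun f hf => absurd (hC f hf.1 hf.2.1 hf.2.2.1) (by simpa using hf.2.2.2)
    rw [hΦ A, hΦ B]
    refine ENNReal.biSup_add_biSup_le' (nonempty A hA0) (nonempty B hB0) fun f hf g hg => ?_
    obtain ⟨hf1, hf2, hf3, hf4⟩ := hf
    obtain ⟨hg1, hg2, hg3, hg4⟩ := hg
    have le : ∀ (C : Set ℂ) (f : ℂ → ℝ), ContDiff ℝ (⊤ : ℕ∞) f → HasCompactSupport f →
        tsupport f ⊆ C → (∃ z, fderiv ℝ f z ≠ 0) →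
        ((∫⁻ z in Ω, ENNReal.ofReal (‖fderiv ℝ (f ∘ φ) z‖ ^ q)) ^ (1 / q) /
          (∫⁻ w in C, ENNReal.ofReal (‖fderiv ℝ f w‖ ^ p)) ^ (1 / p)) ^ κ ≤ Φ C := by
      intro C f h1 h2 h3 h4
      rw [hΦ C]
      exact le_iSup₂_of_le f ⟨h1, h2, h3, h4⟩ le_rfl
    rcases eq_or_ne (((∫⁻ z in Ω, ENNReal.ofReal (‖fderiv ℝ (f ∘ φ) z‖ ^ q)) ^ (1 / q) /
          (∫⁻ w in A, ENNReal.ofReal (‖fderiv ℝ f w‖ ^ p)) ^ (1 / p)) ^ κ) 0 with hr | hr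
    · rw [hr, zero_add]
      exact (le B g hg1 hg2 hg3 hg4).trans (mono _ _ subset_union_right)
    rcases eq_or_ne (((∫⁻ z in Ω, ENNReal.ofReal (‖fderiv ℝ (g ∘ φ) z‖ ^ q)) ^ (1 / q) /
          (∫⁻ w in B, ENNReal.ofReal (‖fderiv ℝ g w‖ ^ p)) ^ (1 / p)) ^ κ) 0 with hs | hs
    · rw [hs, add_zero]
      exact (le A f hf1 hf2 hf3 hf4).trans (mono _ _ subset_union_left)
    rw [setLIntegral_fderiv_eq_lintegral hf3 hp0] at hr ⊢
    rw [setLIntegral_fderiv_eq_lintegral hg3 hp0] at hs ⊢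
    -- Nonvanishing of the ratio together with `hK` makes all energies positive and finite.
    have scaling : ∀ f : ℂ → ℝ, ContDiff ℝ (⊤ : ℕ∞) f → HasCompactSupport f → tsupport f ⊆ Ω' →
        ((∫⁻ z in Ω, ENNReal.ofReal (‖fderiv ℝ (f ∘ φ) z‖ ^ q)) ^ (1 / q) /
          (∫⁻ w, ENNReal.ofReal (‖fderiv ℝ f w‖ ^ p)) ^ (1 / p)) ^ κ ≠ 0 →
        ((∫⁻ z in Ω, ENNReal.ofReal (‖fderiv ℝ (f ∘ φ) z‖ ^ q)) ^ (1 / q) /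
          (∫⁻ w, ENNReal.ofReal (‖fderiv ℝ f w‖ ^ p)) ^ (1 / p)) ^ κ ≠ ∞ ∧
        ∃ c : ℝ, 0 ≤ c ∧
        ENNReal.ofReal (c ^ q) * (∫⁻ z in Ω, ENNReal.ofReal (‖fderiv ℝ (f ∘ φ) z‖ ^ q)) =
          ((∫⁻ z in Ω, ENNReal.ofReal (‖fderiv ℝ (f ∘ φ) z‖ ^ q)) ^ (1 / q) /
          (∫⁻ w, ENNReal.ofReal (‖fderiv ℝ f w‖ ^ p)) ^ (1 / p)) ^ κ ∧
        ENNReal.ofReal (c ^ p) * (∫⁻ w, ENNReal.ofReal (‖fderiv ℝ f w‖ ^ p)) =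
          ((∫⁻ z in Ω, ENNReal.ofReal (‖fderiv ℝ (f ∘ φ) z‖ ^ q)) ^ (1 / q) /
          (∫⁻ w, ENNReal.ofReal (‖fderiv ℝ f w‖ ^ p)) ^ (1 / p)) ^ κ := by
      intro f h1 h2 h3 hr
      have hb := hK f h1 h2 h3
      rw [setLIntegral_fderiv_eq_lintegral h3 hp0] at hb
      generalize (∫⁻ z in Ω, ENNReal.ofReal (‖fderiv ℝ (f ∘ φ) z‖ ^ q)) = e at hb hr ⊢
      generalize (∫⁻ w, ENNReal.ofReal (‖fderiv ℝ f w‖ ^ p)) = n at hb hr ⊢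
      have hp1 : 0 < 1 / p := by positivity
      have hq1 : 0 < 1 / q := by positivity
      have hn0 : n ≠ 0 := by
        rintro rfl
        rw [ENNReal.zero_rpow_of_pos hp1, mul_zero, le_zero_iff] at hb
        rw [hb, ENNReal.zero_div, ENNReal.zero_rpow_of_pos hκ0] at hr
        exact hr rfl
      have hn : n ≠ ∞ := by
        rintro rfl
        rw [ENNReal.top_rpow_of_pos hp1, ENNReal.div_top, ENNReal.zero_rpow_of_pos hκ0] at hr
        exact hr rfl
      have he : e ≠ ∞ := by
        rintro rfl
        rw [ENNReal.top_rpow_of_pos hq1, top_le_iff] at hb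
        exact ENNReal.mul_ne_top ENNReal.ofReal_ne_top
          (ENNReal.rpow_ne_top_of_nonneg hp1.le hn) hb
      refine ⟨?_, exists_scaling_eq_ratio hq0 hqp hκ he hr hn0⟩
      refine ENNReal.rpow_ne_top_of_nonneg hκ0.le (ne_top_of_le_ne_top ENNReal.ofReal_ne_top
        (ENNReal.div_le_of_le_mul hb))
    obtain ⟨hrt, c, hc, hcE, hcN⟩ := scaling f hf1 hf2 (hf3.trans hA) hr
    obtain ⟨hst, d, hd, hdE, hdN⟩ := scaling g hg1 hg2 (hg3.trans hB) hs
    have hfg : Disjoint (tsupport f) (tsupport g) := hAB.mono hf3 hg3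
    have hE := lintegral_fderiv_comp_add_of_disjoint hΩo hφd.continuousOn hq0 hfg hc hd
    have hN := lintegral_fderiv_comp_add_of_disjoint isOpen_univ continuousOn_id hp0 hfg hc hd
    simp only [Measure.restrict_univ, Function.comp_id] at hN
    rw [hcE, hdE] at hE
    rw [hcN, hdN] at hN
    generalize ((∫⁻ z in Ω, ENNReal.ofReal (‖fderiv ℝ (f ∘ φ) z‖ ^ q)) ^ (1 / q) /
          (∫⁻ w, ENNReal.ofReal (‖fderiv ℝ f w‖ ^ p)) ^ (1 / p)) ^ κ = r at *
    generalize ((∫⁻ z in Ω, ENNReal.ofReal (‖fderiv ℝ (g ∘ φ) z‖ ^ q)) ^ (1 / q) /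
          (∫⁻ w, ENNReal.ofReal (‖fderiv ℝ g w‖ ^ p)) ^ (1 / p)) ^ κ = s at *
    have hrs0 : r + s ≠ 0 := by simp [hr]
    have hrst : r + s ≠ ∞ := ENNReal.add_ne_top.2 ⟨hrt, hst⟩
    have hsupp : tsupport (c • f + d • g) ⊆ A ∪ B :=
      (tsupport_add _ _).trans (union_subset_union
        ((closure_mono (Function.support_const_smul_subset c f)).trans hf3)
        ((closure_mono (Function.support_const_smul_subset d g)).trans hg3))
    have key := le (A ∪ B) (c • f + d • g) ((hf1.const_smul c).add (hg1.const_smul d))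
      (hf2.smul_left.add hg2.smul_left) hsupp (by
        by_contra! h
        simp [h, Real.zero_rpow hp0.ne'] at hN
        exact hrs0 hN.symm)
    rw [setLIntegral_fderiv_eq_lintegral hsupp hp0, hE, hN, ← ENNReal.rpow_sub _ _ hrs0 hrst,
      ← hκ, ← ENNReal.rpow_mul, one_div_mul_cancel hκ0.ne', ENNReal.rpow_one] at key
    exact key
  refine ⟨fun A _ _ hA => ?_, fun A₁ A₂ _ _ _ _ _ _ h => mono _ _ h, fun A hA hd => ?_⟩
  · rw [hΦ]
    refine iSup₂_le fun f hf => ENNReal.rpow_le_rpow (ENNReal.div_le_of_le_mul ?_) hκ0.le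
    have := hK f hf.1 hf.2.1 (hf.2.2.1.trans hA)
    rwa [setLIntegral_fderiv_eq_lintegral (hf.2.2.1.trans hA) hp0,
      ← setLIntegral_fderiv_eq_lintegral hf.2.2.1 hp0] at this
  · rw [ENNReal.tsum_eq_iSup_sum]
    refine iSup_le fun s => ?_
    have fin : ∑ k ∈ s, Φ (A k) ≤ Φ (⋃ k ∈ s, A k) := by
      induction s using Finset.induction_on with
      | empty => simp
      | insert a s ha ih =>
        rw [Finset.sum_insert ha, Finset.set_biUnion_insert]
        refine (add_le_add le_rfl ih).trans (superadd _ _ (hA a).2.2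
          (iUnion₂_subset fun k _ => (hA k).2.2) ?_)
        exact disjoint_iUnion₂_right.2 fun k hk => hd fun h => ha (h ▸ hk)
    exact fin.trans (mono _ _ (iUnion₂_subset fun k _ => subset_iUnion A k))
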